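/- If a semigroup (H_t) on probability measures satisfies W_∞(H_t δ_x, H_t δ_y) ≤ e^{−Kt} d(x,y) for all x,y and H_t μ = ∫ (H_t δ_x) dμ(x), then for every p ∈ [1,∞] and all probability measures μ, ν: W_p(H_t μ, H_t ν) ≤ e^{−Kt} W_p(μ, ν). -/

import Mathlib

open MeasureTheory
open scoped ENNReal

/-- The set of couplings of two measures. -/
def couplingSet {X : Type*} [MeasurableSpace X] (μ ν : Measure X) :
    Set (Measure (X × X)) :=
  {σ | σ.map Prod.fst = μ ∧ σ.map Prod.snd = ν}

/-- The `L^p`-Wasserstein distance for `p ∈ [1,∞]` (with `p = ∞` interpreted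
via the essential supremum of the distance over couplings). -/
noncomputable def WassE {X : Type*} [MeasurableSpace X] [MetricSpace X]
    (p : ℝ≥0∞) (μ ν : Measure X) : ℝ≥0∞ :=
  if p = ∞ then
    ⨅ σ ∈ couplingSet μ ν, essSup (fun z : X × X => edist z.1 z.2) σ
  else
    ⨅ σ ∈ couplingSet μ ν, (∫⁻ z, edist z.1 z.2 ^ p.toReal ∂σ) ^ (1 / p.toReal)

section WassersteinContraction

open Filter Topology ProbabilityTheory

lemma isProbabilityMeasure_of_mem_couplingSet {X : Type*} [MeasurableSpace X]
    {μ ν : Measure X} [IsProbabilityMeasure μ] {σ : Measure (X × X)} (hσ : σ ∈ couplingSet μ ν) : IsProbabilityMeasure σ := by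
  refine ⟨?_⟩
  rw [← measure_univ (μ := μ), ← hσ.1, Measure.map_apply measurable_fst MeasurableSet.univ,
    Set.preimage_univ]

variable {X : Type*} [MeasurableSpace X] [MetricSpace X]

lemma exists_coupling_of_WassE_top_lt {μ ν : Measure X} {r : ℝ≥0∞} (h : WassE ∞ μ ν < r) :
    ∃ π ∈ couplingSet μ ν, ∀ᵐ z ∂π, edist z.1 z.2 < r := by
  rw [WassE, if_pos rfl] at h
  simp only [iInf_lt_iff] at h
  obtain ⟨π, hπ, h⟩ := h
  exact ⟨π, hπ, ae_lt_of_essSup_lt h⟩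

lemma measure_le_thickening_of_WassE_top_lt [BorelSpace X] {μ ν : Measure X} {r : ℝ}
    (h : WassE ∞ μ ν < ENNReal.ofReal r) {A : Set X} (hA : MeasurableSet A) :
    μ A ≤ ν (Metric.thickening r A) := by
  obtain ⟨π, ⟨rfl, rfl⟩, hr⟩ := exists_coupling_of_WassE_top_lt h
  rw [Measure.map_apply measurable_fst hA,
    Measure.map_apply measurable_snd Metric.isOpen_thickening.measurableSet]
  refine measure_mono_ae ?_
  filter_upwards [hr] with z hz hzA
  refine (Metric.mem_thickening_iff_exists_edist_lt ..).2 ⟨z.1, hzA, ?_⟩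
  rwa [edist_comm]

lemma exists_measurable_dist_denseSeq_lt [BorelSpace X] [TopologicalSpace.SeparableSpace X]
    [Nonempty X] {ε : ℝ} (hε : 0 < ε) :
    ∃ q : X → ℕ, Measurable q ∧ ∀ x, dist x (TopologicalSpace.denseSeq X (q x)) < ε := by
  classical
  have hex : ∀ x : X, ∃ n, dist x (TopologicalSpace.denseSeq X n) < ε := fun x =>
    (TopologicalSpace.denseRange_denseSeq X).exists_dist_lt x hε
  refine ⟨fun x => Nat.find (hex x), measurable_find hex fun n => ?_, fun x => Nat.find_spec (hex x)⟩
  exact (isOpen_lt (continuous_id.dist continuous_const) continuous_const).measurableSet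

lemma aemeasurable_of_bind_ne_zero {α β : Type*} [MeasurableSpace α] [MeasurableSpace β]
    {μ : Measure α} {f : α → Measure β} (h : μ.bind f ≠ 0) : AEMeasurable f μ := by
  by_contra hf
  exact h (by rw [Measure.bind, Measure.map_of_not_aemeasurable hf, Measure.join_zero])

/-- Weak convergence of mixtures of a `W_∞`-Lipschitz family along pointwise approximations. -/
lemma tendsto_of_lintegral_WassE_top_lt [BorelSpace X]
    {κ : X → Measure X} {μ : Measure X} {τ : ProbabilityMeasure X}
    (hτ : (τ : Measure X) = μ.bind κ) {τs : ℕ → ProbabilityMeasure X} {s : ℕ → X → X}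
    {r : ℕ → ℝ} (hr : Tendsto r atTop (𝓝[>] 0))
    (hτs : ∀ n A, MeasurableSet A → (τs n : Measure X) A = ∫⁻ x, κ (s n x) A ∂μ)
    (hs : ∀ n x, WassE ∞ (κ (s n x)) (κ x) < ENNReal.ofReal (r n)) :
    Tendsto τs atTop (𝓝 τ) := by
  have hκ : AEMeasurable κ μ := aemeasurable_of_bind_ne_zero (by
    rw [← hτ]; exact IsProbabilityMeasure.ne_zero _)
  refine tendsto_of_forall_isClosed_limsup_le' fun F hF => ?_
  have hlim : Tendsto (fun n => (τ : Measure X) (Metric.thickening (r n) F)) atTop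
      (𝓝 ((τ : Measure X) F)) :=
    (tendsto_measure_thickening_of_isClosed ⟨1, one_pos, measure_ne_top _ _⟩ hF).comp hr
  rw [← hlim.limsup_eq]
  refine limsup_le_limsup (Eventually.of_forall fun n => ?_)
  change (τs n : Measure X) F ≤ (τ : Measure X) (Metric.thickening (r n) F)
  rw [hτs n F hF.measurableSet, hτ,
    Measure.bind_apply Metric.isOpen_thickening.measurableSet hκ]
  exact lintegral_mono fun x => measure_le_thickening_of_WassE_top_lt (hs n x) hF.measurableSet

lemma isTightMeasureSet_range_of_tendsto {Y : Type*} [MeasurableSpace Y] [MetricSpace Y]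
    [BorelSpace Y] [CompleteSpace Y] [SecondCountableTopology Y]
    {τs : ℕ → ProbabilityMeasure Y} {τ : ProbabilityMeasure Y} (h : Tendsto τs atTop (𝓝 τ)) :
    IsTightMeasureSet (Set.range fun n => (τs n : Measure Y)) := by
  have hc : IsCompact (closure (Set.range τs)) :=
    h.isCompact_insert_range.closure_of_subset (Set.subset_insert _ _)
  refine (isTightMeasureSet_of_isCompact_closure hc).subset ?_
  rintro _ ⟨n, rfl⟩
  exact ⟨τs n, ⟨n, rfl⟩, rfl⟩

/-- A discretized version of the lifted coupling. -/
lemma exists_approx_coupling_lift [BorelSpace X] [TopologicalSpace.SeparableSpace X] [Nonempty X]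
    {κ : X → Measure X} [∀ x, IsProbabilityMeasure (κ x)] {c : ℝ} (hc : 0 ≤ c)
    (hκ : ∀ x y, WassE ∞ (κ x) (κ y) ≤ ENNReal.ofReal (c * dist x y))
    (σ : Measure (X × X)) [IsProbabilityMeasure σ] {ε : ℝ} (hε : 0 < ε) :
    ∃ (s : X → X) (γ : ProbabilityMeasure ((X × X) × (X × X))), (∀ x, dist (s x) x < ε) ∧
      γ.toMeasure.fst = σ ∧
      (∀ A, MeasurableSet A →
        (γ.toMeasure.snd.fst : Measure X) A = ∫⁻ x, κ (s x) A ∂σ.fst) ∧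
      (∀ A, MeasurableSet A →
        (γ.toMeasure.snd.snd : Measure X) A = ∫⁻ x, κ (s x) A ∂σ.snd) ∧
      ∀ᵐ w ∂γ.toMeasure, dist w.2.1 w.2.2 ≤ c * dist w.1.1 w.1.2 + (2 * c + 1) * ε := by
  have := UniformSpace.secondCountable_of_separable X
  obtain ⟨q, hq, hqd⟩ := exists_measurable_dist_denseSeq_lt (X := X) hε
  set e := TopologicalSpace.denseSeq X
  have hex : ∀ i : ℕ × ℕ, ∃ π ∈ couplingSet (κ (e i.1)) (κ (e i.2)),
      ∀ᵐ z ∂π, edist z.1 z.2 < ENNReal.ofReal (c * dist (e i.1) (e i.2) + ε) := fun i =>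
    exists_coupling_of_WassE_top_lt ((hκ _ _).trans_lt
      ((ENNReal.ofReal_lt_ofReal_iff (by positivity)).2 (by linarith)))
  choose π hπ hπd using hex
  let k : Kernel (X × X) (X × X) :=
    { toFun := fun z => π (q z.1, q z.2)
      measurable' := (Measurable.of_discrete (f := π)).comp
        ((hq.comp measurable_fst).prodMk (hq.comp measurable_snd)) }
  have hk : ∀ z, k z = π (q z.1, q z.2) := fun z => rfl
  have : IsMarkovKernel k :=
    ⟨fun z => isProbabilityMeasure_of_mem_couplingSet (hπ _)⟩
  have hκe : ∀ A : Set X, Measurable fun x => κ (e (q x)) A := fun A =>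
    (measurable_from_top (f := fun n => κ (e n) A)).comp hq
  refine ⟨fun x => e (q x), ⟨σ ⊗ₘ k, inferInstance⟩, fun x => by rw [dist_comm]; exact hqd x,
    Measure.fst_compProd _ _, fun A hA => ?_, fun A hA => ?_, ?_⟩
  · change (σ ⊗ₘ k).snd.fst A = _
    rw [Measure.fst_apply hA, Measure.snd_compProd,
      Measure.bind_apply (measurable_fst hA) k.aemeasurable, Measure.fst,
      lintegral_map (hκe A) measurable_fst]
    refine lintegral_congr fun z => ?_
    rw [hk, ← Measure.map_apply measurable_fst hA, (hπ _).1]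
  · change (σ ⊗ₘ k).snd.snd A = _
    rw [Measure.snd_apply hA, Measure.snd_compProd,
      Measure.bind_apply (measurable_snd hA) k.aemeasurable, Measure.snd,
      lintegral_map (hκe A) measurable_snd]
    refine lintegral_congr fun z => ?_
    rw [hk, ← Measure.map_apply measurable_snd hA, (hπ _).2]
  · change ∀ᵐ w ∂(σ ⊗ₘ k), _
    rw [Measure.ae_compProd_iff (measurableSet_le (by fun_prop) (by fun_prop))]
    refine Eventually.of_forall fun z => ?_
    rw [hk]
    filter_upwards [hπd (q z.1, q z.2)] with u hu
    rw [edist_dist, ENNReal.ofReal_lt_ofReal_iff_of_nonneg dist_nonneg] at hu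
    have h1 := hqd z.1
    have h2 := hqd z.2
    have h3 : dist (e (q z.1)) (e (q z.2)) ≤ dist z.1 z.2 + 2 * ε := by
      have := dist_triangle4 (e (q z.1)) z.1 z.2 (e (q z.2))
      rw [dist_comm (e (q z.1)) z.1] at this
      linarith
    have h4 := mul_le_mul_of_nonneg_left h3 hc
    linarith

/-- If a family of probability measures is `c`-Lipschitz for `W_∞`, every coupling `σ` of `μ` and
`ν` lifts to a joint law of `σ` and a coupling of the mixtures which almost surely expands distances
by at most the factor `c`. -/
lemma exists_coupling_lift [BorelSpace X] [CompleteSpace X] [TopologicalSpace.SeparableSpace X]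
    {κ : X → Measure X} [∀ x, IsProbabilityMeasure (κ x)] {c : ℝ} (hc : 0 ≤ c)
    (hκ : ∀ x y, WassE ∞ (κ x) (κ y) ≤ ENNReal.ofReal (c * dist x y))
    {μ ν : Measure X} [IsProbabilityMeasure μ]
    (hμ : IsProbabilityMeasure (μ.bind κ)) (hν : IsProbabilityMeasure (ν.bind κ))
    {σ : Measure (X × X)} (hσ : σ ∈ couplingSet μ ν) :
    ∃ γ : Measure ((X × X) × (X × X)), γ.fst = σ ∧
      γ.snd ∈ couplingSet (μ.bind κ) (ν.bind κ) ∧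
      ∀ᵐ w ∂γ, dist w.2.1 w.2.2 ≤ c * dist w.1.1 w.1.2 := by
  have := UniformSpace.secondCountable_of_separable X
  have := isProbabilityMeasure_of_mem_couplingSet hσ
  have : Nonempty X := nonempty_of_isProbabilityMeasure μ
  let ε : ℕ → ℝ := fun n => 1 / ((n : ℝ) + 1)
  have hε : ∀ n, 0 < ε n := fun n => Nat.one_div_pos_of_nat
  have hε0 : Tendsto ε atTop (𝓝 0) := tendsto_one_div_add_atTop_nhds_zero_nat
  choose s γs hs hγ₁ hγ₂ hγ₃ hγd using fun n => exists_approx_coupling_lift hc hκ σ (hε n)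
  let r : ℕ → ℝ := fun n => (c + 1) * ε n
  have hr : Tendsto r atTop (𝓝[>] 0) := by
    refine tendsto_nhdsWithin_iff.2 ⟨by simpa using hε0.const_mul (c + 1), ?_⟩
    exact Eventually.of_forall fun n => mul_pos (by linarith) (hε n)
  have hsr : ∀ n x, WassE ∞ (κ (s n x)) (κ x) < ENNReal.ofReal (r n) := fun n x => by
    refine (hκ _ _).trans_lt ((ENNReal.ofReal_lt_ofReal_iff (mul_pos (by linarith) (hε n))).2 ?_)
    have := mul_le_mul_of_nonneg_left (hs n x).le hc
    have := hε n
    linarith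
  have hf₁ : Continuous fun w : (X × X) × (X × X) => w.1 := continuous_fst
  have hf₂ : Continuous fun w : (X × X) × (X × X) => w.2.1 := by fun_prop
  have hf₃ : Continuous fun w : (X × X) × (X × X) => w.2.2 := by fun_prop
  let τ₁ : ProbabilityMeasure X := ⟨μ.bind κ, hμ⟩
  let τ₂ : ProbabilityMeasure X := ⟨ν.bind κ, hν⟩
  have hlim₁ : Tendsto (fun n => (γs n).map hf₂.measurable.aemeasurable) atTop (𝓝 τ₁) := by
    refine tendsto_of_lintegral_WassE_top_lt (μ := μ) rfl hr (s := s) (fun n A hA => ?_) hsr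
    rw [← hσ.1, ← Measure.fst, ← hγ₂ n A hA, Measure.fst, Measure.snd,
      Measure.map_map measurable_fst measurable_snd]
    rfl
  have hlim₂ : Tendsto (fun n => (γs n).map hf₃.measurable.aemeasurable) atTop (𝓝 τ₂) := by
    refine tendsto_of_lintegral_WassE_top_lt (μ := ν) rfl hr (s := s) (fun n A hA => ?_) hsr
    rw [← hσ.2, ← Measure.snd, ← hγ₃ n A hA, Measure.snd, Measure.snd,
      Measure.map_map measurable_snd measurable_snd]
    rfl
  have htight : IsTightMeasureSet {x : Measure _ | ∃ γ ∈ Set.range γs, γ.toMeasure = x} := by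
    refine IsTightMeasureSet.prodMk ?_ (IsTightMeasureSet.prodMk ?_ ?_)
    · refine (isTightMeasureSet_singleton (μ := σ)).subset ?_
      rintro _ ⟨_, ⟨_, ⟨n, rfl⟩, rfl⟩, rfl⟩
      exact hγ₁ n
    · refine (isTightMeasureSet_range_of_tendsto hlim₁).subset ?_
      rintro _ ⟨_, ⟨_, ⟨_, ⟨n, rfl⟩, rfl⟩, rfl⟩, rfl⟩
      exact ⟨n, (Measure.map_map measurable_fst measurable_snd).symm⟩
    · refine (isTightMeasureSet_range_of_tendsto hlim₂).subset ?_
      rintro _ ⟨_, ⟨_, ⟨_, ⟨n, rfl⟩, rfl⟩, rfl⟩, rfl⟩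
      exact ⟨n, (Measure.map_map measurable_snd measurable_snd).symm⟩
  let U : Ultrafilter ℕ := Ultrafilter.of atTop
  have hU : (U : Filter ℕ) ≤ atTop := Ultrafilter.of_le _
  obtain ⟨γ, -, hγ⟩ := (isCompact_closure_of_isTightMeasureSet htight).ultrafilter_le_nhds
    (U.map γs) (by
      rw [le_principal_iff, Ultrafilter.mem_coe, Ultrafilter.mem_map]
      exact univ_mem' fun n => subset_closure ⟨n, rfl⟩)
  replace hγ : Tendsto γs U (𝓝 γ) := hγ
  have hmap : ∀ {Y : Type _} [MeasurableSpace Y] [MetricSpace Y] [BorelSpace Y]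
      {f : (X × X) × (X × X) → Y} (hf : Continuous f) {τ : ProbabilityMeasure Y},
      Tendsto (fun n => (γs n).map hf.measurable.aemeasurable) U (𝓝 τ) →
        γ.toMeasure.map f = τ := by
    intro Y _ _ _ f hf τ hτ
    exact congrArg ProbabilityMeasure.toMeasure (tendsto_nhds_unique
      (ProbabilityMeasure.tendsto_map_of_tendsto_of_continuous γs γ hγ hf) hτ)
  refine ⟨γ, ?_, ⟨?_, ?_⟩, ?_⟩
  · refine hmap hf₁ (τ := ⟨σ, inferInstance⟩) (tendsto_const_nhds.congr fun n => ?_)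
    exact Subtype.ext (hγ₁ n).symm
  · rw [Measure.snd, Measure.map_map measurable_fst measurable_snd]
    exact hmap hf₂ (hlim₁.mono_left hU)
  · rw [Measure.snd, Measure.map_map measurable_snd measurable_snd]
    exact hmap hf₃ (hlim₂.mono_left hU)
  · have hδ : ∀ m : ℕ, ∀ᵐ w ∂γ.toMeasure,
        dist w.2.1 w.2.2 ≤ c * dist w.1.1 w.1.2 + ε m := by
      intro m
      let F : Set ((X × X) × (X × X)) :=
        {w | dist w.2.1 w.2.2 ≤ c * dist w.1.1 w.1.2 + ε m}
      have hF : IsClosed F := isClosed_le (by fun_prop) (by fun_prop)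
      have hev : ∀ᶠ n in (U : Filter ℕ), (γs n : Measure _) F = 1 := by
        have hsmall : Tendsto (fun n => (2 * c + 1) * ε n) atTop (𝓝 0) := by
          simpa using hε0.const_mul (2 * c + 1)
        filter_upwards [hU (hsmall.eventually (gt_mem_nhds (hε m)))] with n hn
        rw [← prob_compl_eq_zero_iff hF.measurableSet]
        refine measure_mono_null ?_ (ae_iff.1 (hγd n))
        intro w hw hw'
        exact hw (hw'.trans (by linarith))
      have hle := ProbabilityMeasure.limsup_measure_closed_le_of_tendsto hγ hF
      rw [limsup_congr hev, limsup_const] at hle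
      exact (prob_compl_eq_zero_iff hF.measurableSet).2 (le_antisymm prob_le_one hle)
    filter_upwards [ae_all_iff.2 hδ] with w hw
    refine ge_of_tendsto' (x := atTop) ?_ hw
    simpa using hε0.const_add (c * dist w.1.1 w.1.2)

lemma WassE_bind_le [BorelSpace X] [CompleteSpace X] [TopologicalSpace.SeparableSpace X]
    {κ : X → Measure X} [∀ x, IsProbabilityMeasure (κ x)] {c : ℝ} (hc : 0 < c)
    (hκ : ∀ x y, WassE ∞ (κ x) (κ y) ≤ ENNReal.ofReal (c * dist x y))
    {μ ν : Measure X} [IsProbabilityMeasure μ]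
    (hμ : IsProbabilityMeasure (μ.bind κ)) (hν : IsProbabilityMeasure (ν.bind κ))
    {p : ℝ≥0∞} (hp : 1 ≤ p) :
    WassE p (μ.bind κ) (ν.bind κ) ≤ ENNReal.ofReal c * WassE p μ ν := by
  have := UniformSpace.secondCountable_of_separable X
  have hc0 : ENNReal.ofReal c ≠ 0 := by simpa using hc
  have hlift : ∀ σ ∈ couplingSet μ ν, ∃ γ : Measure ((X × X) × (X × X)), γ.fst = σ ∧
      γ.snd ∈ couplingSet (μ.bind κ) (ν.bind κ) ∧
      ∀ᵐ w ∂γ, edist w.2.1 w.2.2 ≤ ENNReal.ofReal c * edist w.1.1 w.1.2 := by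
    intro σ hσ
    obtain ⟨γ, h₁, h₂, h₃⟩ := exists_coupling_lift hc.le hκ hμ hν hσ
    refine ⟨γ, h₁, h₂, h₃.mono fun w hw => ?_⟩
    rw [edist_dist, edist_dist, ← ENNReal.ofReal_mul hc.le]
    exact ENNReal.ofReal_le_ofReal hw
  have hmeas : Measurable fun z : X × X => edist z.1 z.2 := by fun_prop
  have hmeas' : Measurable fun w : (X × X) × (X × X) => edist w.1.1 w.1.2 := by fun_prop
  unfold WassE
  split_ifs with hpt
  · simp only [ENNReal.mul_iInf_of_ne hc0 ENNReal.ofReal_ne_top]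
    refine le_iInf₂ fun σ hσ => ?_
    obtain ⟨γ, rfl, h₂, h₃⟩ := hlift σ hσ
    refine (iInf₂_le _ h₂).trans (essSup_le_of_ae_le _ ?_)
    refine (ae_map_iff measurable_snd.aemeasurable
      (measurableSet_le hmeas measurable_const)).2 ?_
    filter_upwards [h₃, ae_of_ae_map measurable_fst.aemeasurable
      (ENNReal.ae_le_essSup (μ := γ.fst) fun z : X × X => edist z.1 z.2)] with w hw hw'
    exact hw.trans (by gcongr)
  · have hp0 : 0 < p.toReal := ENNReal.toReal_pos (by positivity) hpt
    simp only [ENNReal.mul_iInf_of_ne hc0 ENNReal.ofReal_ne_top]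
    refine le_iInf₂ fun σ hσ => ?_
    obtain ⟨γ, rfl, h₂, h₃⟩ := hlift σ hσ
    refine (iInf₂_le _ h₂).trans ?_
    rw [Measure.fst, Measure.snd, lintegral_map (hmeas.pow_const _) measurable_fst,
      lintegral_map (hmeas.pow_const _) measurable_snd]
    calc (∫⁻ w, edist w.2.1 w.2.2 ^ p.toReal ∂γ) ^ (1 / p.toReal)
        ≤ (∫⁻ w, ENNReal.ofReal c ^ p.toReal * edist w.1.1 w.1.2 ^ p.toReal ∂γ)
            ^ (1 / p.toReal) := by
          refine ENNReal.rpow_le_rpow (lintegral_mono_ae (h₃.mono fun w hw => ?_)) (by positivity)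
          rw [← ENNReal.mul_rpow_of_nonneg _ _ hp0.le]
          exact ENNReal.rpow_le_rpow hw hp0.le
      _ = ENNReal.ofReal c * (∫⁻ w, edist w.1.1 w.1.2 ^ p.toReal ∂γ) ^ (1 / p.toReal) := by
          rw [lintegral_const_mul _ (hmeas'.pow_const _),
            ENNReal.mul_rpow_of_nonneg _ _ (by positivity), ← ENNReal.rpow_mul,
            mul_one_div_cancel hp0.ne', ENNReal.rpow_one]

end WassersteinContraction

/-- If a semigroup `H_t` on probability measures contracts the `W_∞`-distance
between heat kernels, `W_∞(H_t δ_x, H_t δ_y) ≤ e^{−Kt} d(x,y)`, and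
`H_t μ = ∫ H_t δ_x dμ(x)`, then `W_p(H_t μ, H_t ν) ≤ e^{−Kt} W_p(μ,ν)` for
every `p ∈ [1,∞]`. -/
theorem Wp_contraction_of_Winf_dirac {X : Type*} [MeasurableSpace X]
    [MetricSpace X] [BorelSpace X] [CompleteSpace X]
    [TopologicalSpace.SeparableSpace X]
    (K t : ℝ) (ht : 0 ≤ t) (H : Measure X → Measure X)
    (hHprob : ∀ μ : Measure X, IsProbabilityMeasure μ →
      IsProbabilityMeasure (H μ))
    (hdirac : ∀ x y : X,
      WassE ∞ (H (Measure.dirac x)) (H (Measure.dirac y)) ≤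
        ENNReal.ofReal (Real.exp (-(K * t)) * dist x y))
    (hlin : ∀ μ : Measure X, IsProbabilityMeasure μ →
      H μ = μ.bind fun x => H (Measure.dirac x)) :
    ∀ p : ℝ≥0∞, 1 ≤ p → ∀ μ ν : Measure X,
      IsProbabilityMeasure μ → IsProbabilityMeasure ν →
      WassE p (H μ) (H ν) ≤ ENNReal.ofReal (Real.exp (-(K * t))) * WassE p μ ν := by
  intro p hp μ ν hμ hν
  have : ∀ x, IsProbabilityMeasure (H (Measure.dirac x)) := fun x => hHprob _ inferInstance
  have hμ' := hHprob μ hμ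
  have hν' := hHprob ν hν
  rw [hlin μ hμ] at hμ' ⊢
  rw [hlin ν hν] at hν' ⊢
  exact WassE_bind_le (Real.exp_pos _) hdirac hμ' hν' hp
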